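/- arXiv:0901.1651 — 2 statements merged into one kernel-verified Lean document; each statement's English description precedes it below -/
import Mathlib

section
/- Let R be a valuation domain such that the total defect d_R(0) (the rank of a maximal immediate extension R̂ as a torsion-free R-module) is finite, and suppose that R/A is Hausdorff and complete in its ideal topology for every nonzero non-Archimedean ideal A of R. Then R is almost maximal. -/
open Pointwise

universe u

/-- Linear compactness of `M` in the discrete topology. -/
def LinearlyCompact (R : Type*) (M : Type*) [CommRing R] [AddCommGroup M]
    [Module R M] : Prop :=
  ∀ (ι : Type) (a : ι → M) (N : ι → Submodule R M),
    (∀ s : Finset ι, ∃ x : M, ∀ i ∈ s, x - a i ∈ N i) →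
    ∃ x : M, ∀ i, x - a i ∈ N i

/-- A maximal valuation ring: linearly compact in the discrete topology. -/
def MaximalRing (R : Type*) [CommRing R] : Prop := LinearlyCompact R R

/-- Almost maximal: every proper quotient by a nonzero ideal is linearly compact. -/
def AlmostMaximalRing (R : Type*) [CommRing R] : Prop :=
  ∀ A : Ideal R, A ≠ ⊥ → LinearlyCompact R (R ⧸ A)

/-- `R/A` is complete in its ideal topology. -/
def CompleteInIdealTopology (R : Type*) [CommRing R] (A : Ideal R) : Prop :=
  ∀ (ι : Type) (a : ι → R) (B : ι → Ideal R),
    (∀ i, A ≤ B i) → (⨅ i, B i) = A →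
    (∀ i j, B i ≤ B j → a i - a j ∈ B j) →
    ∃ x : R, ∀ i, x - a i ∈ B i

/-- The top prime set `M^♯ = {s : sM ⊊ M}` of a module. -/
def sharpSet (R : Type*) (M : Type*) [CommRing R] [AddCommGroup M] [Module R M] : Set R :=
  {s : R | s • (⊤ : Submodule R M) ≠ ⊤}

/-- The top prime set of an ideal. -/
def sharpIdealSet (R : Type*) [CommRing R] (A : Ideal R) : Set R :=
  {s : R | s • A ≠ A}

/-- content ideal of `x` in `U`. -/
def contentIdeal (R : Type*) {U : Type*} [CommRing R] [AddCommGroup U] [Module R U]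
    (x : U) : Ideal R :=
  ⨅ A ∈ {A : Ideal R | x ∈ A • (⊤ : Submodule R U)}, A

/-- uniserial module -/
def IsUniserialModule (R : Type*) (M : Type*) [CommRing R] [AddCommGroup M] [Module R M] : Prop :=
  ∀ N N' : Submodule R M, N ≤ N' ∨ N' ≤ N

/-- relatively divisible (pure) submodule -/
def IsPureSub {R : Type*} {M : Type*} [CommRing R] [AddCommGroup M] [Module R M]
    (B : Submodule R M) : Prop :=
  ∀ (r : R) (x : M), r • x ∈ B → ∃ y ∈ B, r • x = r • y

/-- `S` is a maximal immediate extension of `R`. -/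
def IsMaximalImmediateExt (R S : Type*) [CommRing R] [CommRing S] [Algebra R S] : Prop :=
  Function.Injective (algebraMap R S) ∧
  (∀ s : S, s ≠ 0 → ∃ (r : R) (u : Sˣ), s = algebraMap R S r * u) ∧
  (∀ s : S, ∃ r : R, ¬ IsUnit (s - algebraMap R S r)) ∧
  LinearlyCompact S S

/-- `S` is the completion of `R` in the `R`-topology. -/
def IsRTopCompletion (R S : Type*) [CommRing R] [CommRing S] [Algebra R S] : Prop :=
  Function.Injective (algebraMap R S) ∧
  (∀ s : S, ∀ r : R, r ≠ 0 → ∃ a : R, s - algebraMap R S a ∈ Ideal.span {algebraMap R S r}) ∧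
  (∀ a : R → S,
    (∀ r t : R, r ∈ Ideal.span {t} → a r - a t ∈ Ideal.span {algebraMap R S t}) →
    ∃ s : S, ∀ r : R, r ≠ 0 → s - a r ∈ Ideal.span {algebraMap R S r})

/-- factor of two submodules -/
abbrev quotFactor {R : Type*} {M : Type*} [CommRing R] [AddCommGroup M] [Module R M]
    (H₁ H₂ : Submodule R M) : Type _ :=
  ↥H₂ ⧸ (H₁.comap H₂.subtype)

theorem aux_wf_rec {ι α : Type*} [LinearOrder ι] [WellFoundedLT ι] [Nonempty α]
    (G : ∀ l : ι, (∀ m : ι, m < l → α) → α → Prop)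
    (h : ∀ (l : ι) (f : ∀ m : ι, m < l → α),
      (∀ m (hm : m < l), G m (fun n hn => f n (hn.trans hm)) (f m hm)) → ∃ z, G l f z) :
    ∃ F : ι → α, ∀ l, G l (fun m _ => F m) (F l) := by
  classical
  have wf : WellFounded ((· < ·) : ι → ι → Prop) := wellFounded_lt
  let step : ∀ l : ι, (∀ m : ι, m < l → α) → α := fun l f =>
    if hz : ∃ z, G l f z then hz.choose else Classical.arbitrary α
  let F : ι → α := wf.fix step
  have hF : ∀ l, F l = step l (fun m _ => F m) := fun l => wf.fix_eq step l
  refine ⟨F, fun l => ?_⟩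
  induction l using wf.induction with
  | _ l ih =>
    have hz : ∃ z, G l (fun m _ => F m) z := h l _ (fun m hm => ih m hm)
    have := hz.choose_spec
    rw [hF l]
    simp only [step]
    rw [dif_pos hz]
    exact this

theorem aux_total {R Q : Type*} [CommRing R] [IsDomain R] [ValuationRing R] [Field Q] [Algebra R Q]
    [IsFractionRing R Q] (x y : Q) : (∃ c : R, x = c • y) ∨ (∃ c : R, y = c • x) := by
  by_cases hy : y = 0
  · right; exact ⟨0, by simp [hy]⟩
  by_cases hx : x = 0
  · left; exact ⟨0, by simp [hx]⟩
  rcases ValuationRing.isInteger_or_isInteger R (x / y) with ⟨c, hc⟩ | ⟨c, hc⟩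
  · left; refine ⟨c, ?_⟩
    rw [Algebra.smul_def, hc]; field_simp
  · right; refine ⟨c, ?_⟩
    rw [Algebra.smul_def, hc]; field_simp

/-- the data of a nice rank one quotient. -/
theorem aux_core_wo {R S Q : Type*} [CommRing R] [IsDomain R] [ValuationRing R]
    [CommRing S] [Algebra R S] [Field Q] [Algebra R Q] [IsFractionRing R Q]
    (hlc : LinearlyCompact S S)
    (V : Submodule R S) (hV : ∀ (c : R) (z : S), c ≠ 0 → c • z ∈ V → z ∈ V)
    (φ : V →ₗ[R] Q) (s0 : R)
    (hs0 : ¬ IsUnit s0)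
    (hd : ∀ z : S, ∃ v : V, ∃ w : S, z = v + (s0 * s0) • w)
    (hJ : ∀ s : R, ¬ IsUnit s → ∃ j : V, ∀ v : V, φ j ≠ s • φ v)
    (ι : Type) [LinearOrder ι] [WellFoundedLT ι] [Nonempty ι] (sc : ι → ι)
    (hsc : ∀ i, i < sc i) (hsc2 : ∀ i k, i < k → sc i ≤ k)
    (r a : ι → R) (hr0 : ∀ i, r i ≠ 0)
    (hr : ∀ i k, i < k → ∃ t, ¬ IsUnit t ∧ r k = t * r i)
    (ha : ∀ i k, i ≤ k → r i ∣ a k - a i)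
    (hrs : ∀ k, r k ∣ s0)
    (H : ∀ (l : ι) (q : ι → R), (∀ i, q i ≠ 0) →
      (∃ m0 < l, ∀ m < l, q m ∣ q m0) ∨
      (∃ p, ¬ IsUnit p ∧ ∀ m < l, ∃ m' < l, p * q m ∣ q m')) :
    ∃ x : R, ∀ i, r i ∣ x - a i := by
  classical
  -- comparison in J
  have key : ∀ s : R, ∀ j : V, (∀ v : V, φ j ≠ s • φ v) → ∀ v : V, ∃ c : R, s • φ v = c • φ j := by
    intro s j hj v
    rcases aux_total (R := R) (s • φ v) (φ j) with h | ⟨c, hc⟩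
    · exact h
    · exfalso
      apply hj (c • v)
      rw [hc, map_smul, smul_comm]
  have ne0 : ∀ s : R, ∀ j : V, (∀ v : V, φ j ≠ s • φ v) → φ j ≠ 0 := by
    intro s j hj h
    apply hj 0
    simp [h]
  have cancel : ∀ (x y : R) (z : Q), z ≠ 0 → x • z = y • z → x = y := by
    intro x y z hz h
    rw [Algebra.smul_def, Algebra.smul_def] at h
    exact IsFractionRing.injective R Q (mul_right_cancel₀ hz h)
  obtain ⟨j, hj⟩ := hJ s0 hs0
  have hj0 := ne0 _ _ hj
  have hq : ∀ l : ι, ∃ q : R, (∃ v : V, r (sc l) • φ j = q • φ v) ∧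
      (∀ v : V, ∃ c : R, q • φ v = (r l * c) • φ j) := by
    intro l
    obtain ⟨t, ht, htr⟩ := hr l (sc l) (hsc l)
    obtain ⟨jt, hjt⟩ := hJ t ht
    rcases aux_total (R := R) (φ j) (φ jt) with ⟨c, hc⟩ | ⟨c, hc⟩
    · refine ⟨r (sc l) * c, ⟨jt, by rw [mul_smul, ← hc]⟩, fun v => ?_⟩
      obtain ⟨c', hc'⟩ := key t jt hjt v
      refine ⟨c', ?_⟩
      rw [htr, hc]
      calc (t * r l * c) • φ v = (r l * c) • (t • φ v) := by rw [← mul_smul]; congr 1; ring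
        _ = _ := by rw [hc', ← mul_smul, ← mul_smul]; congr 1; ring
    · refine ⟨r (sc l), ⟨j, rfl⟩, fun v => ?_⟩
      obtain ⟨c', hc'⟩ := key t jt hjt v
      refine ⟨c' * c, ?_⟩
      rw [htr]
      calc (t * r l) • φ v = (r l) • (t • φ v) := by rw [← mul_smul]; congr 1; ring
        _ = _ := by rw [hc', hc, ← mul_smul, ← mul_smul]; congr 1; ring
  choose q hq1 hq2 using hq
  have hq0 : ∀ l, q l ≠ 0 := by
    intro l h
    obtain ⟨v, hv⟩ := hq1 l
    rw [h, zero_smul] at hv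
    apply hr0 (sc l)
    exact cancel _ _ _ hj0 (by rw [hv, zero_smul])
  have hqs : ∀ l, q l ∣ s0 * s0 := by
    intro l
    have h1 : q l ∣ s0 * r (sc l) := by
      rcases ValuationRing.dvd_total (q l) (s0 * r (sc l)) with h | ⟨c, hc⟩
      · exact h
      · exfalso
        obtain ⟨v, hv⟩ := hq1 l
        apply hj (c • v)
        have : r (sc l) • φ j = r (sc l) • (s0 • φ (c • v)) := by
          rw [hv, hc, map_smul, ← mul_smul, ← mul_smul]; congr 1; ring
        rw [Algebra.smul_def, Algebra.smul_def (r (sc l)) (s0 • _)] at this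
        refine mul_left_cancel₀ ?_ this
        intro h0
        exact hr0 (sc l) (IsFractionRing.injective R Q (by rw [h0, map_zero]))
    exact h1.trans (mul_dvd_mul_left _ (hrs _))
  -- limits inside V
  have hlim : ∀ (T : Type) [LinearOrder T] (e : T → ι) (z : T → V),
      (∀ m l, m < l → ∃ w : S, ((z l : S) - z m) = q (e m) • w) →
      ∃ y : V, ∀ m, ∃ w : V, y - z m = q (e m) • w := by
    intro T _ e z hz
    obtain ⟨x, hx⟩ := hlc T (fun m => (z m : S))
      (fun m => Ideal.span {algebraMap R S (q (e m))}) (by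
        intro s
        rcases s.eq_empty_or_nonempty with rfl | hs
        · exact ⟨0, by simp⟩
        · refine ⟨z (s.max' hs), fun i hi => ?_⟩
          rw [Ideal.mem_span_singleton]
          rcases (s.le_max' i hi).eq_or_lt with h | h
          · rw [← h, sub_self]; exact dvd_zero _
          · obtain ⟨w, hw⟩ := hz _ _ h
            exact ⟨w, by rw [hw, Algebra.smul_def]⟩)
    obtain ⟨v, w, hvw⟩ := hd x
    refine ⟨v, fun m => ?_⟩
    have := hx m
    rw [Ideal.mem_span_singleton] at this
    obtain ⟨w1, hw1⟩ := this
    obtain ⟨c, hc⟩ := hqs (e m)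
    have h2 : ((v : S) - z m) = q (e m) • (w1 - c • w) := by
      have : (v : S) = x - (s0 * s0) • w := by rw [hvw]; ring
      rw [smul_sub, ← mul_smul, ← hc, this, Algebra.smul_def (q (e m)), ← hw1]; ring
    have h3 : w1 - c • w ∈ V := by
      apply hV _ _ (hq0 (e m))
      rw [← h2]; exact V.sub_mem v.2 (z m).2
    exact ⟨⟨_, h3⟩, Subtype.ext h2⟩
  have hmono : ∀ m l, m ≤ l → sc m ≤ sc l := by
    intro m l h
    rcases h.eq_or_lt with rfl | h
    · exact le_rfl
    · exact (hsc2 _ _ h).trans (hsc l).le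
  obtain ⟨z, hz⟩ := aux_wf_rec (ι := ι) (α := V)
    (fun l f y => φ y = a (sc l) • φ j ∧ ∀ m (hm : m < l), ∃ w : S, ((y : S) - f m hm) = q m • w)
    (by
      intro l f hf
      obtain ⟨y, hy⟩ := hlim {m // m < l} (fun m => m.1) (fun m => f m.1 m.2)
        (fun m l' h => (hf l'.1 l'.2).2 m.1 h)
      have hc : ∀ m, m < l → ∃ v : V, φ y - a (sc l) • φ j = q m • φ v := by
        intro m hm
        obtain ⟨w, hw⟩ := hy ⟨m, hm⟩
        have h1 : φ y - a (sc m) • φ j = q m • φ w := by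
          rw [← (hf m hm).1, ← map_smul, ← map_sub]; congr 1
        obtain ⟨c, hc⟩ := ha _ _ (hmono m l hm.le)
        obtain ⟨v, hv⟩ := hq1 m
        refine ⟨w - c • v, ?_⟩
        rw [map_sub, smul_sub, ← h1, map_smul, smul_comm, ← hv, ← mul_smul, mul_comm, ← hc, sub_smul]
        abel
      have hd' : ∃ (d : R) (v : V), (∀ m < l, q m ∣ d) ∧ φ y - a (sc l) • φ j = d • φ v := by
        by_cases hl : ∃ m, m < l
        · rcases H l q hq0 with ⟨m0, hm0, h0⟩ | ⟨p, hp, hpp⟩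
          · obtain ⟨v, hv⟩ := hc m0 hm0
            exact ⟨q m0, v, h0, hv⟩
          · obtain ⟨j', hj'⟩ := hJ p hp
            have he : ∀ m < l, ∃ e : R, φ y - a (sc l) • φ j = (q m * e) • φ j' := by
              intro m hm
              obtain ⟨m', hm', c, hcc⟩ := hpp m hm
              obtain ⟨v, hv⟩ := hc m' hm'
              obtain ⟨e, he⟩ := key p j' hj' v
              refine ⟨c * e, ?_⟩
              rw [hv, hcc]
              calc (p * q m * c) • φ v = (q m * c) • (p • φ v) := by
                    rw [← mul_smul]; congr 1; ring
                _ = _ := by rw [he, ← mul_smul]; congr 1; ring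
            obtain ⟨m, hm⟩ := hl
            obtain ⟨e, hee⟩ := he m hm
            refine ⟨q m * e, j', fun m' hm' => ?_, hee⟩
            obtain ⟨e', he'⟩ := he m' hm'
            rw [hee] at he'
            exact ⟨e', cancel _ _ _ (ne0 _ _ hj') he'⟩
        · push Not at hl
          refine ⟨1, y - a (sc l) • j, fun m hm => absurd hm (not_lt.2 (hl m)), ?_⟩
          simp
      obtain ⟨d, v, hd1, hd2⟩ := hd'
      refine ⟨y - d • v, ?_, fun m hm => ?_⟩
      · rw [map_sub, map_smul, ← hd2]; abel
      · obtain ⟨w, hw⟩ := hy ⟨m, hm⟩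
        obtain ⟨c, hc⟩ := hd1 m hm
        refine ⟨w - c • v, ?_⟩
        have : (y : S) - f m hm = q m • (w : S) := congrArg Subtype.val hw
        rw [smul_sub, ← this, ← mul_smul, ← hc]
        simp only [Submodule.coe_sub, Submodule.coe_smul]
        abel)
  obtain ⟨y, hy⟩ := hlim ι id z (fun m l h => (hz l).2 m h)
  have hfin : ∀ l, ∃ c : R, φ y - a (sc l) • φ j = (r l * c) • φ j := by
    intro l
    obtain ⟨w, hw⟩ := hy l
    obtain ⟨c, hc⟩ := hq2 l w
    refine ⟨c, ?_⟩
    rw [← hc, ← (hz l).1, ← map_sub, hw, map_smul]; rfl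
  obtain ⟨l0⟩ := ‹Nonempty ι›
  obtain ⟨c0, hc0⟩ := hfin l0
  have hx : φ y = (a (sc l0) + r l0 * c0) • φ j := by
    rw [add_smul, ← hc0]; abel
  refine ⟨a (sc l0) + r l0 * c0, fun l => ?_⟩
  obtain ⟨c, hc⟩ := hfin l
  rw [hx, ← sub_smul] at hc
  have h1 := cancel _ _ _ hj0 hc
  have h2 := ha l (sc l) (hsc l).le
  have : a (sc l0) + r l0 * c0 - a l = r l * c + (a (sc l) - a l) := by
    rw [← h1]; ring
  rw [this]
  exact dvd_add (dvd_mul_right _ _) h2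

theorem aux_nonunit {R : Type*} [CommRing R] [IsDomain R] [ValuationRing R] {x y : R}
    (h : ¬ x ∣ y) : ∃ t, ¬ IsUnit t ∧ x = t * y := by
  rcases ValuationRing.dvd_total x y with h' | ⟨t, ht⟩
  · exact absurd h' h
  · refine ⟨t, fun hu => h ?_, by rw [ht, mul_comm]⟩
    rw [ht]
    obtain ⟨u, rfl⟩ := hu
    exact ⟨(u⁻¹ : Rˣ), by simp⟩

/-- A coinitial subfamily indexed by a well order all of whose initial segments are small. -/
theorem aux_wo {R : Type*} [CommRing R] [IsDomain R] [ValuationRing R]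
    (ι : Type) (r : ι → R) :
    ∃ (T : Type) (_ : LinearOrder T) (_ : WellFoundedLT T) (f : T → ι),
      (∀ i, ∃ t, r i ∣ r (f t)) ∧
      (∀ s t, s < t → ¬ r (f t) ∣ r (f s)) ∧
      (∀ t : T, ∀ g : {s // s < t} → ι, ∃ i, ∀ s, ¬ r i ∣ r (g s)) := by
  classical
  let C : Set Cardinal.{0} := {c | ∃ (K : Type) (f : K → ι), Cardinal.mk K = c ∧ ∀ i, ∃ k, r i ∣ r (f k)}
  have hC : C.Nonempty := ⟨Cardinal.mk ι, ι, id, rfl, fun i => ⟨i, dvd_rfl⟩⟩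
  obtain ⟨κ, hκ, hmin⟩ := (wellFounded_lt (α := Cardinal.{0})).has_min C hC
  obtain ⟨K, f0, hK, hf0⟩ := hκ
  have he : Cardinal.mk κ.ord.ToType = Cardinal.mk K := by simp [hK]
  obtain ⟨e⟩ := Cardinal.eq.1 he
  let f1 : κ.ord.ToType → ι := fun x => f0 (e x)
  have hf1 : ∀ i, ∃ k, r i ∣ r (f1 k) := by
    intro i
    obtain ⟨k, hk⟩ := hf0 i
    exact ⟨e.symm k, by simpa [f1] using hk⟩
  let T := {t : κ.ord.ToType // ∀ s < t, ¬ r (f1 t) ∣ r (f1 s)}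
  have lt_wf : WellFoundedLT T := inferInstance
  refine ⟨T, inferInstance, lt_wf, fun t => f1 t.1, ?_, ?_, ?_⟩
  · intro i
    obtain ⟨t, ht, htm⟩ := (wellFounded_lt (α := κ.ord.ToType)).has_min {k | r i ∣ r (f1 k)} (hf1 i)
    refine ⟨⟨t, fun s hs h => ?_⟩, ht⟩
    exact htm s (dvd_trans ht h) hs
  · intro s t h
    exact t.2 s.1 h
  · intro t g
    by_contra hcon
    push Not at hcon
    have hmem : Cardinal.mk {s : T // s < t} ∈ C := ⟨_, g, rfl, hcon⟩
    apply hmin _ hmem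
    refine lt_of_le_of_lt ?_ (Cardinal.mk_Iio_toType_ord_lt t.1)
    refine Cardinal.mk_le_of_injective (f := fun s => ⟨s.1.1, s.2⟩) ?_
    intro a b h
    apply Subtype.ext; apply Subtype.ext
    have h' := congrArg Subtype.val h
    exact h'

theorem aux_core {R S Q : Type*} [CommRing R] [IsDomain R] [ValuationRing R]
    [CommRing S] [Algebra R S] [Field Q] [Algebra R Q] [IsFractionRing R Q]
    (hlc : LinearlyCompact S S)
    (V : Submodule R S) (hV : ∀ (c : R) (z : S), c ≠ 0 → c • z ∈ V → z ∈ V)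
    (φ : V →ₗ[R] Q) (s0 : R)
    (hs0 : ¬ IsUnit s0)
    (hd : ∀ z : S, ∃ v : V, ∃ w : S, z = v + (s0 * s0) • w)
    (hJ : ∀ s : R, ¬ IsUnit s → ∃ j : V, ∀ v : V, φ j ≠ s • φ v)
    (ι : Type) [Nonempty ι] (r a : ι → R)
    (hatt : ∀ i, ∃ k, ¬ r k ∣ r i)
    (harch : ∀ s, ¬ IsUnit s → ∃ i, ∀ k, r k ∣ s * r i)
    (ha : ∀ i k, r i ∣ r k → r i ∣ a k - a i)
    (hrs : ∀ k, r k ∣ s0) :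
    ∃ x : R, ∀ i, r i ∣ x - a i := by
  classical
  obtain ⟨T, _, _, f, hf1, hf2, hf3⟩ := aux_wo ι r
  have hr0 : ∀ i, r i ≠ 0 := by
    intro i h
    obtain ⟨k, hk⟩ := hatt i
    exact hk (h ▸ dvd_zero _)
  have hex : ∀ t : T, ∃ t', t < t' := by
    intro t
    obtain ⟨k, hk⟩ := hatt (f t)
    obtain ⟨t', ht'⟩ := hf1 k
    refine ⟨t', ?_⟩
    by_contra hcon
    rcases (not_lt.1 hcon).eq_or_lt with rfl | h
    · exact hk ht'
    · have := hf2 _ _ h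
      exact hk (ht'.trans ((ValuationRing.dvd_total _ _).resolve_left this))
  have hne : Nonempty T := ⟨(hf1 (Classical.arbitrary ι)).choose⟩
  have hex2 : ∀ t : T, ∃ t', t < t' ∧ ∀ k, t < k → t' ≤ k := by
    intro t
    obtain ⟨t', ht, htm⟩ := (wellFounded_lt (α := T)).has_min {k | t < k} (hex t)
    exact ⟨t', ht, fun k hk => not_lt.1 (htm k hk)⟩
  choose sc hsc hsc2 using hex2
  have hle : ∀ i k, i ≤ k → r (f i) ∣ r (f k) := by
    intro i k h
    rcases h.eq_or_lt with rfl | h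
    · exact dvd_rfl
    · exact (ValuationRing.dvd_total _ _).resolve_right (hf2 _ _ h)
  obtain ⟨x, hx⟩ := aux_core_wo (Q := Q) hlc V hV φ s0 hs0 hd hJ T sc hsc hsc2 (fun t => r (f t))
    (fun t => a (f t)) (fun i => hr0 _) (fun i k h => aux_nonunit (hf2 _ _ h))
    (fun i k h => ha _ _ (hle _ _ h)) (fun k => hrs _) (by
      intro l q hq0
      by_contra hcon
      push Not at hcon
      obtain ⟨h1, h2⟩ := hcon
      have h1' : ∀ m : {m // m < l}, ∃ g, ¬ IsUnit g ∧ ∃ m' < l, q m' = g * q m.1 := by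
        intro m
        obtain ⟨m', hm', h⟩ := h1 m.1 m.2
        obtain ⟨g, hg, hg'⟩ := aux_nonunit h
        exact ⟨g, hg, m', hm', hg'⟩
      choose g hg n hn hgn using h1'
      have h3 : ∀ m : {m // m < l}, ∃ i, ∀ k, r k ∣ g m * r i := fun m => harch _ (hg m)
      choose I hI using h3
      obtain ⟨i, hi⟩ := hf3 l I
      obtain ⟨i', hi'⟩ := hatt i
      obtain ⟨t, ht, hti⟩ := aux_nonunit hi'
      obtain ⟨i'', hi''⟩ := hatt i'
      obtain ⟨m, hm, hmm⟩ := h2 t ht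
      have h4 := hmm _ (hn ⟨m, hm⟩)
      have h5 : q (n ⟨m, hm⟩) ∣ t * q m := (ValuationRing.dvd_total _ _).resolve_right h4
      rw [hgn] at h5
      have h6 : g ⟨m, hm⟩ ∣ t := (mul_dvd_mul_iff_right (hq0 m)).1 h5
      apply hi''
      rw [hti]
      refine (hI ⟨m, hm⟩ i'').trans (mul_dvd_mul h6 ?_)
      exact (ValuationRing.dvd_total _ _).resolve_right (hi ⟨m, hm⟩))
  refine ⟨x, fun i => ?_⟩
  obtain ⟨t, ht⟩ := hf1 i
  have h1 := ht.trans (hx t)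
  have h2 := ha _ _ ht
  have : x - a i = (x - a (f t)) + (a (f t) - a i) := by ring
  rw [this]
  exact dvd_add h1 h2

theorem aux_core2 {R S Q : Type*} [CommRing R] [IsDomain R] [ValuationRing R]
    [CommRing S] [Algebra R S] [Field Q] [Algebra R Q] [IsFractionRing R Q]
    (hlc : LinearlyCompact S S)
    (V : Submodule R S) (hV : ∀ (c : R) (z : S), c ≠ 0 → c • z ∈ V → z ∈ V)
    (φ : V →ₗ[R] Q) (s0 : R)
    (hs0 : ¬ IsUnit s0)
    (hd : ∀ z : S, ∃ v : V, ∃ w : S, z = v + (s0 * s0) • w)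
    (hJ : ∀ s : R, ¬ IsUnit s → ∃ j : V, ∀ v : V, φ j ≠ s • φ v)
    (ι : Type) (r a : ι → R)
    (hatt : ∀ i, ∃ k, ¬ r k ∣ r i)
    (harch : ∀ s, ¬ IsUnit s → ∃ i, ∀ k, r k ∣ s * r i)
    (ha : ∀ i k, r i ∣ r k → r i ∣ a k - a i) :
    ∃ x : R, ∀ i, r i ∣ x - a i := by
  classical
  have hr0 : ∀ i, r i ≠ 0 := by
    intro i h
    obtain ⟨k, hk⟩ := hatt i
    exact hk (h ▸ dvd_zero _)
  obtain ⟨i0, hi0⟩ := harch s0 hs0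
  let T := {k // r i0 ∣ r k}
  have hne : Nonempty T := ⟨⟨i0, dvd_rfl⟩⟩
  have h1 : ∀ k : T, ∃ c, r k.1 = r i0 * c := fun k => k.2
  have h2 : ∀ k : T, ∃ c, a k.1 - a i0 = r i0 * c := fun k => ha _ _ k.2
  choose r' hr' using h1
  choose a' ha' using h2
  have hdv : ∀ x y : R, x ∣ y ↔ r i0 * x ∣ r i0 * y := fun x y =>
    (mul_dvd_mul_iff_left (hr0 i0)).symm
  obtain ⟨x, hx⟩ := aux_core (Q := Q) hlc V hV φ s0 hs0 hd hJ T r' a'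
    (by
      intro i
      obtain ⟨k, hk⟩ := hatt i.1
      refine ⟨⟨k, i.2.trans ((ValuationRing.dvd_total _ _).resolve_left hk)⟩, ?_⟩
      rw [hdv, ← hr', ← hr']; exact hk)
    (by
      intro s hs
      obtain ⟨i, hi⟩ := harch s hs
      have : ∃ i' : T, r i ∣ r i'.1 := by
        rcases ValuationRing.dvd_total (r i) (r i0) with h | h
        · exact ⟨⟨i0, dvd_rfl⟩, h⟩
        · exact ⟨⟨i, h⟩, dvd_rfl⟩
      obtain ⟨i', hi'⟩ := this
      refine ⟨i', fun k => ?_⟩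
      rw [hdv, ← hr', mul_left_comm, ← hr']
      exact (hi k.1).trans (mul_dvd_mul_left _ hi'))
    (by
      intro i k h
      rw [hdv, ← hr', ← hr'] at h
      rw [hdv, ← hr', mul_sub, ← ha', ← ha']
      have := ha _ _ h
      convert this using 1; ring)
    (by
      intro k
      rw [hdv, ← hr', mul_comm]
      exact hi0 k.1)
  refine ⟨a i0 + r i0 * x, fun i => ?_⟩
  rcases ValuationRing.dvd_total (r i0) (r i) with h | h
  · have h3 := hx ⟨i, h⟩
    rw [hdv, ← hr', mul_sub, ← ha'] at h3
    convert h3 using 1; ring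
  · have h3 := ha _ _ h
    have : a i0 + r i0 * x - a i = r i0 * x + (a i0 - a i) := by ring
    rw [this]
    exact dvd_add (h.mul_right _) h3

theorem aux_functional {R V : Type u} [CommRing R] [IsDomain R] [AddCommGroup V] [Module R V]
    (hV : ∀ (c : R) (z : V), c • z = 0 → c = 0 ∨ z = 0) (v : V) (hv : v ≠ 0) :
    ∃ φ : V →ₗ[R] FractionRing R, φ v ≠ 0 := by
  let M := LocalizedModule (nonZeroDivisors R) V
  let ι : V →ₗ[R] M := LocalizedModule.mkLinearMap (nonZeroDivisors R) V
  have h1 : ι v ≠ 0 := by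
    intro h
    rw [IsLocalizedModule.eq_zero_iff (nonZeroDivisors R)] at h
    obtain ⟨s, hs⟩ := h
    rcases hV s.1 v hs with h | h
    · exact nonZeroDivisors.coe_ne_zero s h
    · exact hv h
  have h2 : ¬ ∀ f : Module.Dual (FractionRing R) M, f (ι v) = 0 := by
    rw [Module.forall_dual_apply_eq_zero_iff]; exact h1
  push Not at h2
  obtain ⟨f, hf⟩ := h2
  refine ⟨(f.restrictScalars R).comp ι, ?_⟩
  exact hf

theorem aux_data {R S : Type u} [CommRing R] [IsDomain R] [ValuationRing R]
    [CommRing S] [IsDomain S] [Algebra R S]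
    (hinj : Function.Injective (algebraMap R S))
    (hloc : ∀ s : R, IsUnit (algebraMap R S s) → IsUnit s)
    (hfin : Module.rank R S < Cardinal.aleph0) :
    ∃ (V : Submodule R S) (φ : V →ₗ[R] FractionRing R) (s0 : R),
      (∀ (c : R) (z : S), c ≠ 0 → c • z ∈ V → z ∈ V) ∧
      ¬ IsUnit s0 ∧
      (∀ z : S, ∃ v : V, ∃ w : S, z = v + (s0 * s0) • w) ∧
      (∀ s : R, ¬ IsUnit s → ∃ j : V, ∀ v : V, φ j ≠ s • φ v) := by
  classical
  have htf : ∀ (c : R) (z : S), c • z = 0 → c = 0 ∨ z = 0 := by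
    intro c z h
    rw [Algebra.smul_def, mul_eq_zero] at h
    rcases h with h | h
    · left; exact hinj (by rw [h, map_zero])
    · right; exact h
  let good : Submodule R S → Prop := fun V =>
    (∀ (c : R) (z : S), c ≠ 0 → c • z ∈ V → z ∈ V) ∧
      ∃ s : R, ¬ IsUnit s ∧ ∀ z : S, ∃ v ∈ V, ∃ w : S, z = v + s • w
  let C : Set Cardinal.{u} := {n | ∃ V : Submodule R S, good V ∧ Module.rank R V = n}
  have hC : C.Nonempty := ⟨_, ⊤, ⟨fun _ _ _ _ => trivial, 0, not_isUnit_zero,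
    fun z => ⟨z, trivial, 0, by simp⟩⟩, rfl⟩
  obtain ⟨n, ⟨V, ⟨hV, s0, hs0, hd⟩, hn⟩, hmin⟩ := (wellFounded_lt (α := Cardinal.{u})).has_min C hC
  have hVne : ∃ v : V, v ≠ 0 := by
    by_contra hcon
    push Not at hcon
    apply hs0
    apply hloc
    obtain ⟨v, hv, w, hw⟩ := hd 1
    have : v = 0 := congrArg Subtype.val (hcon ⟨v, hv⟩)
    rw [this, zero_add, Algebra.smul_def] at hw
    exact IsUnit.of_mul_eq_one w hw.symm
  obtain ⟨v0, hv0⟩ := hVne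
  obtain ⟨φ, hφ⟩ := aux_functional (R := R) (V := V) (by
    intro c z h
    rcases htf c z (congrArg Subtype.val h) with h | h
    · exact Or.inl h
    · exact Or.inr (Subtype.ext h)) v0 hv0
  refine ⟨V, φ, s0, hV, hs0, ?_, ?_⟩
  · intro z
    obtain ⟨v, hv, w, hw⟩ := hd z
    obtain ⟨v', hv', w', hw'⟩ := hd w
    refine ⟨⟨v + s0 • v', V.add_mem hv (V.smul_mem _ hv')⟩, w', ?_⟩
    rw [hw, hw', smul_add, mul_smul, add_assoc]
  · intro s hs
    by_contra hcon
    push Not at hcon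
    let V' : Submodule R S := (LinearMap.ker φ).map V.subtype
    have hV' : ∀ z : S, z ∈ V' ↔ ∃ h : z ∈ V, φ ⟨z, h⟩ = 0 := by
      intro z
      simp [V']
    have hrank : Module.rank R V' < n := by
      have e : Module.rank R V' = Module.rank R (LinearMap.ker φ) :=
        ((LinearMap.ker φ).equivMapOfInjective V.subtype V.injective_subtype).symm.rank_eq
      rw [e, ← hn, ← rank_quotient_add_rank_of_isDomain (LinearMap.ker φ)]
      have hfinV : Module.rank R V < Cardinal.aleph0 := (Submodule.rank_le V).trans_lt hfin
      have hk : Module.rank R (LinearMap.ker φ) < Cardinal.aleph0 :=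
        (Submodule.rank_le _).trans_lt hfinV
      have hq : 0 < Module.rank R (V ⧸ LinearMap.ker φ) := by
        rw [φ.quotKerEquivRange.rank_eq, rank_pos_iff_exists_ne_zero]
        exact ⟨⟨φ v0, v0, rfl⟩, fun h => hφ (congrArg Subtype.val h)⟩
      have hq' : Module.rank R (V ⧸ LinearMap.ker φ) < Cardinal.aleph0 :=
        (rank_quotient_le _).trans_lt hfinV
      obtain ⟨x, hx⟩ := Cardinal.lt_aleph0.1 hk
      obtain ⟨y, hy⟩ := Cardinal.lt_aleph0.1 hq'
      rw [hy] at hq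
      rw [hx, hy]
      have : 0 < y := by exact_mod_cast hq
      exact_mod_cast (by omega : x < y + x)
    refine hmin _ ⟨V', ⟨?_, ?_⟩, rfl⟩ hrank
    · intro c z hc hz
      rw [hV'] at hz ⊢
      obtain ⟨h1, h2⟩ := hz
      have h3 := hV c z hc h1
      refine ⟨h3, ?_⟩
      have : c • φ ⟨z, h3⟩ = 0 := by rw [← map_smul]; exact h2
      rw [Algebra.smul_def, mul_eq_zero] at this
      rcases this with h | h
      · exact absurd (IsFractionRing.injective R (FractionRing R) (by rw [h, map_zero])) hc
      · exact h
    · have hdec : ∀ z : S, ∃ v ∈ V', ∃ w w' : S, z = v + s • w + s0 • w' := by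
        intro z
        obtain ⟨v, hv, w', hw⟩ := hd z
        obtain ⟨u, hu⟩ := hcon ⟨v, hv⟩
        refine ⟨v - s • (u : S), ?_, u, w', ?_⟩
        · rw [hV']
          refine ⟨V.sub_mem hv (V.smul_mem _ u.2), ?_⟩
          have : (⟨v - s • (u : S), V.sub_mem hv (V.smul_mem _ u.2)⟩ : V) = ⟨v, hv⟩ - s • u := rfl
          rw [this, map_sub, map_smul, hu, sub_self]
        · rw [hw]; abel
      rcases ValuationRing.dvd_total s s0 with ⟨c, hc⟩ | ⟨c, hc⟩
      · refine ⟨s, hs, fun z => ?_⟩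
        obtain ⟨v, hv, w, w', h⟩ := hdec z
        exact ⟨v, hv, w + c • w', by rw [h, hc, smul_add, mul_smul, add_assoc]⟩
      · refine ⟨s0, hs0, fun z => ?_⟩
        obtain ⟨v, hv, w, w', h⟩ := hdec z
        exact ⟨v, hv, c • w + w', by rw [h, hc, smul_add, mul_smul, add_assoc]⟩

theorem stmt_3 (R S : Type u) [CommRing R] [IsDomain R] [ValuationRing R]
    [CommRing S] [IsDomain S] [ValuationRing S] [Algebra R S]
    (hS : IsMaximalImmediateExt R S) (hfin : Module.rank R S < Cardinal.aleph0)
    (hcomp : ∀ A : Ideal R, A ≠ ⊥ →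
      (∃ s : R, ¬ IsUnit s ∧ s • A = A) →
      ((⨅ B ∈ {B : Ideal R | A < B}, B) = A ∧ CompleteInIdealTopology R A)) :
    AlmostMaximalRing R := by
  classical
  obtain ⟨hinj, -, hres, hlc⟩ := hS
  have hloc : ∀ s : R, IsUnit (algebraMap R S s) → IsUnit s := by
    intro s hs
    by_contra hns
    obtain ⟨w, hw⟩ := hs.exists_right_inv
    obtain ⟨c, hc⟩ := hres w
    apply hc
    have h1 : IsUnit (1 - s * c) := by
      rcases IsLocalRing.isUnit_or_isUnit_one_sub_self (s * c) with h | h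
      · exact absurd (isUnit_of_mul_isUnit_left h) hns
      · exact h
    have h2 : algebraMap R S s * (w - algebraMap R S c) = algebraMap R S (1 - s * c) := by
      rw [map_sub, map_one, map_mul, ← hw]; ring
    have h3 := h1.map (algebraMap R S)
    rw [← h2] at h3
    exact isUnit_of_mul_isUnit_right h3
  obtain ⟨V, φ, s0, hV, hs0, hd, hJ⟩ := aux_data hinj hloc hfin
  intro A0 hA0 ι a0 N hfs
  have hsur : ∀ i, ∃ b : R, Submodule.Quotient.mk b = a0 i := fun i =>
    Submodule.Quotient.mk_surjective _ (a0 i)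
  choose a ha using hsur
  let B : ι → Ideal R := fun i => (N i).comap A0.mkQ
  have hB : ∀ i x, x ∈ B i ↔ (Submodule.Quotient.mk x : R ⧸ A0) ∈ N i := fun i x => Iff.rfl
  have hA0B : ∀ i, A0 ≤ B i := by
    intro i x hx
    rw [hB, (Submodule.Quotient.mk_eq_zero A0).2 hx]
    exact (N i).zero_mem
  have hcompat : ∀ i j, B i ≤ B j → a i - a j ∈ B j := by
    intro i j h
    obtain ⟨x, hx⟩ := hfs {i, j}
    obtain ⟨y, rfl⟩ := Submodule.Quotient.mk_surjective _ x
    have h1 : y - a i ∈ B i := by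
      rw [hB, Submodule.Quotient.mk_sub, ha]; exact hx i (by simp)
    have h2 : y - a j ∈ B j := by
      rw [hB, Submodule.Quotient.mk_sub, ha]; exact hx j (by simp)
    have : a i - a j = (y - a j) - (y - a i) := by ring
    rw [this]
    exact (B j).sub_mem h2 (h h1)
  suffices hmain : ∃ x : R, ∀ i, x - a i ∈ B i by
    obtain ⟨x, hx⟩ := hmain
    refine ⟨Submodule.Quotient.mk x, fun i => ?_⟩
    have := hx i
    rwa [hB, Submodule.Quotient.mk_sub, ha] at this
  rcases isEmpty_or_nonempty ι with hemp | hne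
  · exact ⟨0, fun i => (hemp.false i).elim⟩
  let A : Ideal R := ⨅ i, B i
  have hAB : ∀ i, A ≤ B i := fun i => iInf_le B i
  have hA : A ≠ ⊥ := by
    intro h
    apply hA0
    rw [eq_bot_iff, ← h]
    exact le_iInf hA0B
  by_cases hna : ∃ s : R, ¬ IsUnit s ∧ s • A = A
  · exact (hcomp A hA hna).2 ι a B hAB rfl hcompat
  push Not at hna
  have htot : ∀ I J : Ideal R, I ≤ J ∨ J ≤ I := le_total
  have htot' : ∀ (x : R) (I : Ideal R), x ∉ I → ∀ y ∈ I, x ∣ y := by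
    intro x I hx y hy
    rcases ValuationRing.dvd_total x y with h | h
    · exact h
    · exact absurd (I.mem_of_dvd h hy) hx
  by_cases hatt : ∃ i, B i ≤ A
  · obtain ⟨i, hi⟩ := hatt
    refine ⟨a i, fun k => hcompat i k (hi.trans (hAB k))⟩
  push Not at hatt
  have hnext : ∀ i, ∃ k, ∃ x ∈ B i, x ∉ B k := by
    intro i
    obtain ⟨x, hx, hxA⟩ := SetLike.not_le_iff_exists.1 (not_le_of_gt (hatt i))
    have : ¬ ∀ k, x ∈ B k := fun h => hxA ((Submodule.mem_iInf B).2 h)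
    push Not at this
    obtain ⟨k, hk⟩ := this
    exact ⟨k, x, hx, hk⟩
  choose n r hrB hrn using hnext
  have hnr : ∀ i, ∀ y ∈ B (n i), r i ∣ y := fun i => htot' _ _ (hrn i)
  have hmemA : ∀ y, y ∈ A ↔ ∀ k, r k ∣ y := by
    intro y
    constructor
    · intro h k
      exact hnr k y (hAB _ h)
    · intro h
      exact (Submodule.mem_iInf B).2 fun i => (B i).mem_of_dvd (h i) (hrB i)
  have hrA : ∀ i, r i ∉ A := fun i h => hrn i (hAB _ h)
  obtain ⟨x, hx⟩ := aux_core2 hlc V hV φ s0 hs0 hd hJ ι r (fun i => a (n i))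
    (by
      intro i
      by_contra hcon
      push Not at hcon
      exact hrA i ((hmemA _).2 hcon))
    (by
      intro s hs
      by_contra hcon
      push Not at hcon
      apply hna s hs
      have hs0' : s ≠ 0 := by
        rintro rfl
        obtain ⟨k, hk⟩ := hcon (Classical.arbitrary ι)
        exact hk (by simp)
      apply le_antisymm
      · intro y hy
        obtain ⟨b, hb, rfl⟩ := (Submodule.mem_smul_pointwise_iff_exists _ _ _).1 hy
        exact A.mul_mem_left _ hb
      · intro y hy
        have h1 : ∀ i, s * r i ∣ y := by
          intro i
          apply htot' _ A _ y hy
          intro h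
          obtain ⟨k, hk⟩ := hcon i
          exact hk ((hmemA _).1 h k)
        rw [Submodule.mem_smul_pointwise_iff_exists]
        have h2 : s ∣ y := by
          exact (dvd_mul_right s _).trans (h1 (Classical.arbitrary ι))
        obtain ⟨b, rfl⟩ := h2
        exact ⟨b, (hmemA _).2 fun k => (mul_dvd_mul_iff_left hs0').1 (h1 k), rfl⟩)
    (by
      intro i k h
      rcases htot (B (n k)) (B (n i)) with h1 | h1
      · exact hnr i _ (hcompat _ _ h1)
      · have := hnr k _ (hcompat _ _ h1)
        rw [← neg_sub]
        exact (dvd_neg.2 (h.trans this)))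
  refine ⟨x, fun i => ?_⟩
  have h1 : x - a (n i) ∈ B i := (B i).mem_of_dvd (hx i) (hrB i)
  have h2 : a (n i) - a i ∈ B i := by
    apply hcompat
    intro y hy
    exact (B i).mem_of_dvd (hnr i y hy) (hrB i)
  have : x - a i = (x - a (n i)) + (a (n i) - a i) := by ring
  rw [this]
  exact (B i).add_mem h1 h2
end

section
/- Let R be a valuation domain and G a torsion-free R-module of finite rank. Then G has a pure-composition series 0 = H_0 ⊂ H_1 ⊂ ... ⊂ H_n = G whose factors U_k = H_k/H_{k−1} are uniserial torsion-free modules satisfying U_k^# ⊇ U_{k+1}^# for all 1 ≤ k ≤ n−1. -/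
open Pointwise

universe u

/-- relative purity, elementwise -/
def RelPure {R M : Type*} [CommRing R] [AddCommGroup M] [Module R M]
    (A N : Submodule R M) : Prop :=
  ∀ (r : R) (x : M), r ≠ 0 → x ∈ N → r • x ∈ A → x ∈ A

/-- divisibility by `t` -/
def DivBy {R M : Type*} [CommRing R] [AddCommGroup M] [Module R M]
    (t : R) (N : Submodule R M) : Prop :=
  ∀ x ∈ N, ∃ y ∈ N, x = t • y

lemma quot_nzsd {R M : Type*} [CommRing R] [IsDomain R] [AddCommGroup M] [Module R M]
    (A : Submodule R M) (h : RelPure A ⊤) : NoZeroSMulDivisors R (M ⧸ A) := by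
  constructor
  intro c x hx
  obtain ⟨x, rfl⟩ := A.mkQ_surjective x
  by_cases hc : c = 0
  · exact Or.inl hc
  · right
    rw [← map_smul, Submodule.mkQ_apply, Submodule.Quotient.mk_eq_zero] at hx
    rw [Submodule.mkQ_apply, Submodule.Quotient.mk_eq_zero]
    exact h c x hc trivial hx

lemma rank_lt_top {R M : Type u} [CommRing R] [IsDomain R] [AddCommGroup M] [Module R M]
    (hfin : Module.rank R M < Cardinal.aleph0)
    (A : Submodule R M) (h : RelPure A ⊤) (hne : A ≠ ⊤) :
    Module.finrank R A < Module.finrank R M := by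
  have := quot_nzsd A h
  have : Nontrivial (M ⧸ A) := Submodule.Quotient.nontrivial_iff.2 hne
  have h1 := Submodule.rank_quotient_add_rank A
  have h2 : 0 < Module.rank R (M ⧸ A) := rank_pos
  have h3 : Module.rank R (M ⧸ A) < Cardinal.aleph0 :=
    lt_of_le_of_lt (by rw [← h1]; exact self_le_add_right _ _) hfin
  have h4 : Module.rank R A < Cardinal.aleph0 :=
    lt_of_le_of_lt (by rw [← h1]; exact self_le_add_left _ _) hfin
  unfold Module.finrank
  rw [← h1, Cardinal.toNat_add h3 h4]
  have : 0 < Cardinal.toNat (Module.rank R (M ⧸ A)) := Cardinal.toNat_pos.2 ⟨h2.ne', h3⟩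
  omega

lemma finrank_lt_rel {R M : Type u} [CommRing R] [IsDomain R] [AddCommGroup M] [Module R M]
    (hfin : Module.rank R M < Cardinal.aleph0)
    (A N : Submodule R M) (hle : A ≤ N) (h : RelPure A N) (hne : A ≠ N) :
    Module.finrank R A < Module.finrank R N := by
  have := rank_lt_top (M := N) (lt_of_le_of_lt (Submodule.rank_le N) hfin) (A.comap N.subtype)
    (fun r x hr _ hx => h r x hr x.2 hx) (by
      intro h'
      exact hne (le_antisymm hle (Submodule.comap_subtype_eq_top.1 h')))
  rwa [(Submodule.comapSubtypeEquivOfLe hle).finrank_eq] at this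

lemma exists_functional {R M : Type u} [CommRing R] [IsDomain R] [AddCommGroup M] [Module R M]
    [NoZeroSMulDivisors R M] (x : M) (hx : x ≠ 0) :
    ∃ f : M →ₗ[R] FractionRing R, f x ≠ 0 := by
  let Q := FractionRing R
  let ι : M →ₗ[R] TensorProduct R Q M := TensorProduct.mk R Q M 1
  have hι : ι x ≠ 0 := by
    intro h
    have hl : IsLocalizedModule (nonZeroDivisors R) ι :=
      (isLocalizedModule_iff_isBaseChange (nonZeroDivisors R) Q ι).2
        (TensorProduct.isBaseChange R M Q)
    obtain ⟨c, hc⟩ := (IsLocalizedModule.eq_zero_iff (nonZeroDivisors R) ι).1 h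
    rcases smul_eq_zero.1 (show (c : R) • x = 0 from hc) with h0 | h0
    · exact nonZeroDivisors.coe_ne_zero c h0
    · exact hx h0
  obtain ⟨φ, hφ⟩ : ∃ φ : Module.Dual Q (TensorProduct R Q M), φ (ι x) ≠ 0 := by
    by_contra! hcon
    exact hι ((Module.forall_dual_apply_eq_zero_iff Q _).1 hcon)
  exact ⟨(φ.restrictScalars R).comp ι, hφ⟩

lemma frac_total {R : Type*} [CommRing R] [IsDomain R] [ValuationRing R] (a b : FractionRing R) :
    (∃ r : R, a = r • b) ∨ (∃ r : R, b = r • a) := by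
  by_cases hb : b = 0
  · right; exact ⟨0, by simp [hb]⟩
  by_cases ha : a = 0
  · left; exact ⟨0, by simp [ha]⟩
  rcases ValuationRing.isInteger_or_isInteger R (a / b) with ⟨r, hr⟩ | ⟨r, hr⟩
  · left; refine ⟨r, ?_⟩
    rw [Algebra.smul_def, hr]; field_simp
  · right; refine ⟨r, ?_⟩
    rw [Algebra.smul_def, hr]; field_simp

lemma exists_good {R M : Type u} [CommRing R] [IsDomain R] [ValuationRing R]
    [AddCommGroup M] [Module R M] [NoZeroSMulDivisors R M]
    (hfin : Module.rank R M < Cardinal.aleph0) (n : ℕ) :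
    ∀ N : Submodule R M, Module.finrank R N ≤ n →
    ∃ V ≤ N, RelPure V N ∧
      (∀ x ∈ V, ∀ y ∈ V, (∃ r : R, x = r • y) ∨ (∃ r : R, y = r • x)) ∧
      (∀ t : R, DivBy t V ↔ DivBy t N) ∧ (V = ⊥ → N = ⊥) := by
  induction n with
  | zero =>
    intro N hN
    have hb : N = ⊥ := by
      by_contra hne
      have := finrank_lt_rel hfin ⊥ N bot_le (by
        intro r x hr _ hx
        rcases smul_eq_zero.1 ((Submodule.mem_bot R).1 hx) with h | h
        · exact absurd h hr
        · simpa using h) (Ne.symm hne)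
      omega
    subst hb
    refine ⟨⊥, le_rfl, fun r x _ hx _ => hx, ?_, fun t => Iff.rfl, fun _ => rfl⟩
    intro x hx y hy
    left
    rw [Submodule.mem_bot] at hx
    exact ⟨0, by simp [hx]⟩
  | succ n ih =>
    intro N hN
    by_cases hb : N = ⊥
    · exact ih N (by subst hb; simp)
    obtain ⟨z, hzN, hz⟩ := Submodule.exists_mem_ne_zero_of_ne_bot hb
    obtain ⟨f, hf⟩ := exists_functional (R := R) z hz
    -- uniserial criterion
    have huni : ∀ V : Submodule R M, (∀ v ∈ V, f v = 0 → v = 0) →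
        ∀ x ∈ V, ∀ y ∈ V, (∃ r : R, x = r • y) ∨ (∃ r : R, y = r • x) := by
      intro V hV x hx y hy
      rcases frac_total (f x) (f y) with ⟨r, hr⟩ | ⟨r, hr⟩
      · left; refine ⟨r, sub_eq_zero.1 (hV _ (V.sub_mem hx (V.smul_mem r hy)) ?_)⟩
        rw [map_sub, map_smul, hr, sub_self]
      · right; refine ⟨r, sub_eq_zero.1 (hV _ (V.sub_mem hy (V.smul_mem r hx)) ?_)⟩
        rw [map_sub, map_smul, hr, sub_self]
    let A : Submodule R M := N ⊓ LinearMap.ker f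
    have hAN : A ≤ N := inf_le_left
    have hAp : RelPure A N := by
      intro r x hr hx hrx
      refine ⟨hx, ?_⟩
      have h0 : f (r • x) = 0 := hrx.2
      rw [map_smul] at h0
      rcases smul_eq_zero.1 h0 with h | h
      · exact absurd h hr
      · exact h
    have hAne : A ≠ N := by
      intro h
      have : z ∈ A := h ▸ hzN
      exact hf this.2
    have hlt := finrank_lt_rel hfin A N hAN hAp hAne
    by_cases hAb : A = ⊥
    · refine ⟨N, le_rfl, fun r x _ hx _ => hx, huni N ?_, fun t => Iff.rfl, fun h => h⟩
      intro v hv hfv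
      have : v ∈ A := ⟨hv, hfv⟩
      rw [hAb] at this
      simpa using this
    have hdiv : ∀ t, DivBy t N → DivBy t A := by
      intro t ht x hx
      by_cases ht0 : t = 0
      · subst ht0
        obtain ⟨y, hy, hxy⟩ := ht x hx.1
        refine ⟨0, A.zero_mem, by simpa using hxy⟩
      · obtain ⟨y, hy, hxy⟩ := ht x hx.1
        exact ⟨y, hAp t y ht0 hy (hxy ▸ hx), hxy⟩
    by_cases hsh : ∀ t, DivBy t A → DivBy t N
    · obtain ⟨V, hVA, hVp, hVu, hVd, hVb⟩ := ih A (by omega)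
      refine ⟨V, hVA.trans hAN, ?_, hVu, fun t => (hVd t).trans ⟨hsh t, hdiv t⟩,
        fun h => absurd (hVb h) hAb⟩
      intro r x hr hx hrx
      exact hVp r x hr (hAp r x hr hx (hVA hrx)) hrx
    push Not at hsh
    obtain ⟨s, hsA, hsN⟩ := hsh
    have hs0 : s ≠ 0 := by
      rintro rfl
      apply hAb
      rw [eq_bot_iff]
      intro x hx
      obtain ⟨y, _, hy⟩ := hsA x hx
      simpa using hy
    obtain ⟨g, hgN, hg⟩ : ∃ g ∈ N, ∀ y ∈ N, f g ≠ s • f y := by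
      by_contra! hcon
      apply hsN
      intro x hx
      obtain ⟨y, hy, hxy⟩ := hcon x hx
      obtain ⟨a, ha, hae⟩ := hsA (x - s • y)
        ⟨N.sub_mem hx (N.smul_mem s hy), by
          rw [SetLike.mem_coe, LinearMap.mem_ker, map_sub, map_smul, hxy, sub_self]⟩
      refine ⟨y + a, N.add_mem hy ha.1, ?_⟩
      rw [smul_add, ← hae]; abel
    have hfg : f g ≠ 0 := by
      intro h
      exact hg 0 N.zero_mem (by simp [h])
    let V : Submodule R M :=
      { carrier := {v | v ∈ N ∧ ∃ r : R, r ≠ 0 ∧ ∃ q : R, r • v = q • g}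
        zero_mem' := ⟨N.zero_mem, 1, one_ne_zero, 0, by simp⟩
        add_mem' := by
          rintro a b ⟨ha, r, hr, q, hq⟩ ⟨hb, r', hr', q', hq'⟩
          refine ⟨N.add_mem ha hb, r * r', mul_ne_zero hr hr', r' * q + r * q', ?_⟩
          rw [smul_add, add_smul, mul_smul r' q, mul_smul r q', ← hq, ← hq', smul_smul, smul_smul,
            mul_comm r' r]
        smul_mem' := by
          rintro c a ⟨ha, r, hr, q, hq⟩
          refine ⟨N.smul_mem c ha, r, hr, c * q, ?_⟩
          rw [mul_smul, ← hq, smul_comm] }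
    have hVN : V ≤ N := fun v hv => hv.1
    have hgV : g ∈ V := ⟨hgN, 1, one_ne_zero, 1, rfl⟩
    have hVp : RelPure V N := by
      rintro r x hr hx ⟨_, r', hr', q, hq⟩
      exact ⟨hx, r' * r, mul_ne_zero hr' hr, q, by rw [mul_smul, hq]⟩
    have hVinj : ∀ v ∈ V, f v = 0 → v = 0 := by
      rintro v ⟨hv, r, hr, q, hq⟩ hfv
      have h1 : f (r • v) = f (q • g) := by rw [hq]
      rw [map_smul, map_smul, hfv, smul_zero] at h1
      rcases smul_eq_zero.1 h1.symm with h | h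
      · subst h
        rw [zero_smul] at hq
        rcases smul_eq_zero.1 hq with h | h
        · exact absurd h hr
        · exact h
      · exact absurd h hfg
    have hdec : ∀ x ∈ N, ∃ a ∈ A, x - a ∈ V := by
      intro x hx
      rcases frac_total (f (s • x)) (f g) with ⟨r, hr⟩ | ⟨r, hr⟩
      · obtain ⟨a, ha, hae⟩ := hsA (s • x - r • g)
          ⟨N.sub_mem (N.smul_mem s hx) (N.smul_mem r hgN), by
            rw [SetLike.mem_coe, LinearMap.mem_ker, map_sub, hr, map_smul, sub_self]⟩
        refine ⟨a, ha, N.sub_mem hx ha.1, s, hs0, r, ?_⟩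
        rw [smul_sub, ← hae]; abel
      · exfalso
        apply hg (r • x) (N.smul_mem r hx)
        rw [hr, map_smul, map_smul, smul_comm]
    have hsV : ¬ DivBy s V := by
      intro h
      obtain ⟨v, hv, hgv⟩ := h g hgV
      exact hg v hv.1 (by rw [hgv, map_smul])
    refine ⟨V, hVN, hVp, huni V hVinj, fun t => ⟨?_, ?_⟩, ?_⟩
    · intro ht
      have htA : DivBy t A := by
        rcases ValuationRing.cond t s with ⟨c, hc | hc⟩
        · intro x hx
          obtain ⟨y, hy, hxy⟩ := hsA x hx
          exact ⟨c • y, A.smul_mem c hy, by rw [smul_smul, hc, hxy]⟩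
        · exfalso
          apply hsV
          intro x hx
          obtain ⟨y, hy, hxy⟩ := ht x hx
          exact ⟨c • y, V.smul_mem c hy, by rw [smul_smul, hc, hxy]⟩
      intro x hx
      obtain ⟨a, ha, hxa⟩ := hdec x hx
      obtain ⟨b, hb, hab⟩ := htA a ha
      obtain ⟨v, hv, hxv⟩ := ht _ hxa
      refine ⟨b + v, N.add_mem hb.1 hv.1, ?_⟩
      rw [smul_add, ← hab, ← hxv]; abel
    · intro ht x hx
      by_cases ht0 : t = 0
      · subst ht0
        obtain ⟨y, hy, hxy⟩ := ht x hx.1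
        exact ⟨0, V.zero_mem, by simpa using hxy⟩
      · obtain ⟨y, hy, hxy⟩ := ht x hx.1
        exact ⟨y, hVp t y ht0 hy (hxy ▸ hx), hxy⟩
    · intro h
      exfalso
      rw [h, Submodule.mem_bot] at hgV
      exact hfg (by rw [hgV, map_zero])

lemma exists_step {R G : Type u} [CommRing R] [IsDomain R] [ValuationRing R]
    [AddCommGroup G] [Module R G]
    (hfin : Module.rank R G < Cardinal.aleph0) (N : Submodule R G) (hN : RelPure N ⊤) :
    ∃ W : Submodule R G, N ≤ W ∧ RelPure W ⊤ ∧
      (∀ x ∈ W, ∀ y ∈ W, (∃ r : R, x - r • y ∈ N) ∨ (∃ r : R, y - r • x ∈ N)) ∧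
      (∀ t : R, (∀ x ∈ W, ∃ y ∈ W, x - t • y ∈ N) ↔ (∀ x, ∃ y, x - t • y ∈ N)) ∧
      (W = N → N = ⊤) := by
  have := quot_nzsd N hN
  have hq : Module.rank R (G ⧸ N) < Cardinal.aleph0 := lt_of_le_of_lt (rank_quotient_le N) hfin
  obtain ⟨V, -, hVp, hVu, hVd, hVb⟩ := exists_good hq _ (⊤ : Submodule R (G ⧸ N)) le_rfl
  have key : ∀ (x y : G) (r : R), N.mkQ x = r • N.mkQ y ↔ x - r • y ∈ N := by
    intro x y r
    rw [← map_smul, ← sub_eq_zero, ← map_sub, Submodule.mkQ_apply, Submodule.Quotient.mk_eq_zero]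
  refine ⟨V.comap N.mkQ, ?_, ?_, ?_, ?_, ?_⟩
  · intro x hx
    rw [Submodule.mem_comap, Submodule.mkQ_apply, (Submodule.Quotient.mk_eq_zero N).2 hx]
    exact V.zero_mem
  · intro r x hr _ hx
    rw [Submodule.mem_comap, map_smul] at hx
    exact hVp r _ hr trivial hx
  · intro x hx y hy
    simpa only [key] using hVu _ hx _ hy
  · intro t
    have h1 : (∀ x ∈ V.comap N.mkQ, ∃ y ∈ V.comap N.mkQ, x - t • y ∈ N) ↔ DivBy t V := by
      constructor
      · intro h x hx
        obtain ⟨x, rfl⟩ := N.mkQ_surjective x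
        obtain ⟨y, hy, hxy⟩ := h x hx
        exact ⟨_, hy, (key _ _ _).2 hxy⟩
      · intro h x hx
        obtain ⟨y, hy, hxy⟩ := h _ hx
        obtain ⟨y, rfl⟩ := N.mkQ_surjective y
        exact ⟨y, hy, (key _ _ _).1 hxy⟩
    rw [h1, hVd]
    constructor
    · intro h x
      obtain ⟨y, hy, hxy⟩ := h (N.mkQ x) trivial
      obtain ⟨y, rfl⟩ := N.mkQ_surjective y
      exact ⟨y, (key _ _ _).1 hxy⟩
    · intro h x _
      obtain ⟨x, rfl⟩ := N.mkQ_surjective x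
      obtain ⟨y, hxy⟩ := h x
      exact ⟨_, trivial, (key _ _ _).2 hxy⟩
  · intro h
    have hb : V = ⊥ := by
      rw [eq_bot_iff]
      intro x hx
      obtain ⟨x, rfl⟩ := N.mkQ_surjective x
      have : x ∈ N := h ▸ (show x ∈ V.comap N.mkQ from hx)
      rw [Submodule.mem_bot, Submodule.mkQ_apply, (Submodule.Quotient.mk_eq_zero N).2 this]
    have ht := hVb hb
    rw [eq_top_iff]
    intro x _
    have : N.mkQ x ∈ (⊥ : Submodule R (G ⧸ N)) := ht ▸ trivial
    rwa [Submodule.mem_bot, Submodule.mkQ_apply, Submodule.Quotient.mk_eq_zero] at this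

lemma mkQ_key {R G : Type*} [CommRing R] [AddCommGroup G] [Module R G]
    (N W : Submodule R G) (x y : W) (r : R) :
    (N.comap W.subtype).mkQ x = r • (N.comap W.subtype).mkQ y ↔ (x : G) - r • (y : G) ∈ N := by
  rw [← map_smul, ← sub_eq_zero, ← map_sub, Submodule.mkQ_apply, Submodule.Quotient.mk_eq_zero]
  rfl

lemma sharp_iff {R G : Type*} [CommRing R] [AddCommGroup G] [Module R G]
    (N W : Submodule R G) (t : R) :
    t ∉ sharpSet R (quotFactor N W) ↔ (∀ x ∈ W, ∃ y ∈ W, x - t • y ∈ N) := by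
  unfold sharpSet
  rw [Set.mem_ofPred_eq, not_not, eq_top_iff]
  constructor
  · intro h x hx
    have := h (show (N.comap W.subtype).mkQ ⟨x, hx⟩ ∈ _ from trivial)
    obtain ⟨y, _, hy⟩ := (Submodule.mem_smul_pointwise_iff_exists _ _ _).1 this
    obtain ⟨y, rfl⟩ := (N.comap W.subtype).mkQ_surjective y
    exact ⟨y, y.2, (mkQ_key N W ⟨x, hx⟩ y t).1 hy.symm⟩
  · intro h x _
    obtain ⟨x, rfl⟩ := (N.comap W.subtype).mkQ_surjective x
    obtain ⟨y, hy, hxy⟩ := h x x.2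
    exact (Submodule.mem_smul_pointwise_iff_exists _ _ _).2
      ⟨_, trivial, ((mkQ_key N W x ⟨y, hy⟩ t).2 hxy).symm⟩

lemma uni_of {R G : Type*} [CommRing R] [AddCommGroup G] [Module R G]
    (N W : Submodule R G)
    (h : ∀ x ∈ W, ∀ y ∈ W, (∃ r : R, x - r • y ∈ N) ∨ (∃ r : R, y - r • x ∈ N)) :
    IsUniserialModule R (quotFactor N W) := by
  intro P P'
  by_contra hcon
  push Not at hcon
  obtain ⟨h1, h2⟩ := hcon
  obtain ⟨x, hx, hx'⟩ := SetLike.not_le_iff_exists.1 h1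
  obtain ⟨y, hy, hy'⟩ := SetLike.not_le_iff_exists.1 h2
  obtain ⟨x, rfl⟩ := (N.comap W.subtype).mkQ_surjective x
  obtain ⟨y, rfl⟩ := (N.comap W.subtype).mkQ_surjective y
  rcases h x x.2 y y.2 with ⟨r, hr⟩ | ⟨r, hr⟩
  · rw [← mkQ_key] at hr
    exact hx' (hr ▸ P'.smul_mem r hy)
  · rw [← mkQ_key] at hr
    exact hy' (hr ▸ P.smul_mem r hx)

/-- every torsion-free module of finite rank over a valuation domain
has a pure-composition series with uniserial torsion-free factors whose top primes
decrease along the series. -/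
theorem stmt_13 (R : Type u) [CommRing R] [IsDomain R] [ValuationRing R]
    (G : Type u) [AddCommGroup G] [Module R G] [NoZeroSMulDivisors R G]
    (hfin : Module.rank R G < Cardinal.aleph0) :
    ∃ (n : ℕ) (H : Fin (n + 1) → Submodule R G),
      Monotone H ∧ H 0 = ⊥ ∧ H (Fin.last n) = ⊤ ∧
      (∀ k, IsPureSub (H k)) ∧
      (∀ k : Fin n,
        IsUniserialModule R (quotFactor (H k.castSucc) (H k.succ)) ∧
        NoZeroSMulDivisors R (quotFactor (H k.castSucc) (H k.succ))) ∧
      (∀ k l : Fin n, k ≤ l →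
        sharpSet R (quotFactor (H l.castSucc) (H l.succ)) ⊆
          sharpSet R (quotFactor (H k.castSucc) (H k.succ))) := by
  classical
  let S := {N : Submodule R G // RelPure N ⊤}
  have hex : ∀ N : S, ∃ W : S, N.1 ≤ W.1 ∧
      (∀ x ∈ W.1, ∀ y ∈ W.1, (∃ r : R, x - r • y ∈ N.1) ∨ (∃ r : R, y - r • x ∈ N.1)) ∧
      (∀ t : R, (∀ x ∈ W.1, ∃ y ∈ W.1, x - t • y ∈ N.1) ↔ (∀ x, ∃ y, x - t • y ∈ N.1)) ∧
      (W.1 = N.1 → N.1 = ⊤) := by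
    rintro ⟨N, hN⟩
    obtain ⟨W, h1, h2, h3⟩ := exists_step hfin N hN
    exact ⟨⟨W, h2⟩, h1, h3⟩
  choose step hle huni hsh hstrict using hex
  have hbot : RelPure (⊥ : Submodule R G) ⊤ := by
    intro r x hr _ hx
    rcases smul_eq_zero.1 ((Submodule.mem_bot R).1 hx) with h | h
    · exact absurd h hr
    · simpa using h
  let K : ℕ → S := fun k => step^[k] ⟨⊥, hbot⟩
  have hK : ∀ k, K (k + 1) = step (K k) := fun k => Function.iterate_succ_apply' _ _ _
  have hmono : Monotone (fun k => (K k).1) := monotone_nat_of_le_succ (fun k => by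
    simp only [hK]; exact hle _)
  have hrank : ∀ k, (K k).1 = ⊤ ∨ k ≤ Module.finrank R (K k).1 := by
    intro k
    induction k with
    | zero => right; exact Nat.zero_le _
    | succ k ih =>
      by_cases ht : (K k).1 = ⊤
      · left
        exact top_le_iff.1 (ht.symm.le.trans (hmono (Nat.le_succ k)))
      · right
        have h1 := ih.resolve_left ht
        have := finrank_lt_rel hfin (K k).1 (K (k + 1)).1 (hmono (Nat.le_succ k))
          (fun r x hr _ hx => (K k).2 r x hr trivial hx)
          (fun h => ht (hstrict (K k) (by rw [← hK]; exact h.symm)))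
        omega
  have htop : (K (Module.finrank R G + 1)).1 = ⊤ := by
    rcases hrank (Module.finrank R G + 1) with h | h
    · exact h
    · exfalso
      have : Module.finrank R (K (Module.finrank R G + 1)).1 ≤ Module.finrank R G :=
        Cardinal.toNat_le_toNat (Submodule.rank_le _) hfin
      omega
  refine ⟨Module.finrank R G + 1, fun k => (K k).1, ?_, rfl, ?_, ?_, ?_, ?_⟩
  · intro a b hab
    exact hmono hab
  · exact htop
  · intro k r x hx
    by_cases hr : r = 0
    · exact ⟨0, Submodule.zero_mem _, by simp [hr]⟩
    · exact ⟨x, (K k).2 r x hr trivial hx, rfl⟩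
  · intro k
    refine ⟨uni_of _ _ ?_, ?_⟩
    · have := huni (K k)
      rw [← hK] at this
      exact this
    · exact quot_nzsd _ (fun r x hr _ hx => (K k).2 r x hr trivial hx)
  · intro k l hkl t
    contrapose
    rw [sharp_iff, sharp_iff]
    have h1 := hsh (K k) t
    have h2 := hsh (K l) t
    rw [← hK] at h1 h2
    intro h
    refine h2.2 ?_
    intro x
    obtain ⟨y, hy⟩ := h1.1 h x
    exact ⟨y, hmono (show (k : ℕ) ≤ l from hkl) hy⟩
end
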